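/- B = A[X;*]^fl is alternative (i.e. (pp)q = p(pq) and (qp)p = q(pp) for all p, q ∈ B) if and only if A is alternative ((aa)b = a(ab) and (ba)a = b(aa) for all a, b ∈ A), aa* commutes with every element of A for every a ∈ A, and 2a + a* lies in the nucleus N(A) for every a ∈ A, where N(A) is the set of elements that associate with all pairs of elements of A in all three positions of the associator (a,b,c) := (ab)c − a(bc). -/

import Mathlib

/-- `tau n a b = ab` if `n` is even and `ba` if `n` is odd. -/
def tau {A : Type*} [NonAssocRing A] (n : ℕ) (a b : A) : A :=
  if Even n then a * b else b * a

/-- The `m`-fold iterate `*^m` of the involution `*`. -/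
def starIter {A : Type*} [NonAssocRing A] [StarRing A] : ℕ → A → A
  | 0, a => a
  | m+1, a => star (starIter m a)

/-- The multiplication of the flipped non-associative skew polynomial ring `B = A[X;*]^fl`:
the biadditive extension of `(aX^m)(bX^n) = τ_n(a, *^m(b)) X^{m+n}`. Polynomials are
represented as finitely supported functions `ℕ →₀ A`. -/
noncomputable def fmul {A : Type*} [NonAssocRing A] [StarRing A] (p q : ℕ →₀ A) : ℕ →₀ A :=
  p.sum fun m a => q.sum fun n b => Finsupp.single (m+n) (tau n a (starIter m b))

/-- The map `α : B → B`, `α(Σ_i a_i X^i) = Σ_i (−1)^i *^{i+1}(a_i) X^i`. -/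
noncomputable def alphaMap {A : Type*} [NonAssocRing A] [StarRing A] (p : ℕ →₀ A) : ℕ →₀ A :=
  p.sum fun i a => Finsupp.single i ((-1 : ℤ) ^ i • starIter (i+1) a)

/-- The map `β : B → B`, `β(Σ_i a_i X^i) = Σ_i *^{i+1}(a_i) X^i`. -/
noncomputable def betaMap {A : Type*} [NonAssocRing A] [StarRing A] (p : ℕ →₀ A) : ℕ →₀ A :=
  p.sum fun i a => Finsupp.single i (starIter (i+1) a)

section

variable {A : Type*} [NonAssocRing A]

theorem associator_swap_left (hl : ∀ a b : A, a * a * b = a * (a * b)) (a b c : A) :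
    associator a b c = -associator b a c := by
  have h1 := hl (a + b) c
  have h2 := hl a c
  have h3 := hl b c
  simp only [mul_add, add_mul] at h1
  simp only [associator_apply]
  grind

theorem associator_swap_right (hr : ∀ a b : A, b * a * a = b * (a * a)) (a b c : A) :
    associator a b c = -associator a c b := by
  have h1 := hr (b + c) a
  have h2 := hr b a
  have h3 := hr c a
  simp only [mul_add, add_mul] at h1
  simp only [associator_apply]
  grind

theorem mul_mul_eq_add_associator (a b c : A) :
    a * b * c = a * (b * c) + associator a b c := by
  simp [associator_apply]

theorem tau_add_left (n : ℕ) (a b c : A) : tau n (a + b) c = tau n a c + tau n b c := by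
  unfold tau; split_ifs <;> simp [add_mul, mul_add]

theorem tau_add_right (n : ℕ) (a b c : A) : tau n a (b + c) = tau n a b + tau n a c := by
  unfold tau; split_ifs <;> simp [add_mul, mul_add]

theorem tau_zero_left (n : ℕ) (a : A) : tau n 0 a = 0 := by simp [tau]

theorem tau_zero_right (n : ℕ) (a : A) : tau n a 0 = 0 := by simp [tau]

variable [StarRing A]

theorem add_star_mul_comm (hn : ∀ a b : A, (a * star a) * b = b * (a * star a)) (a b : A) :
    (a + star a) * b = b * (a + star a) := by
  have h1 := hn (a + 1) b
  have h2 := hn a b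
  simp only [star_add, star_one, mul_add, add_mul, mul_one, one_mul] at h1 ⊢
  grind

theorem mul_star_add_mul_star_comm (hn : ∀ a b : A, (a * star a) * b = b * (a * star a))
    (a b c : A) :
    (a * star b) * c + (b * star a) * c = c * (a * star b) + c * (b * star a) := by
  have h1 := hn (a + b) c
  have h2 := hn a c
  have h3 := hn b c
  simp only [star_add, mul_add, add_mul] at h1
  grind

/-- The conditions on `A` equivalent to `A[X;*]^fl` being alternative, with the nucleus
condition on `2a + a*` rephrased in terms of associators. -/
structure IsFlippable (A : Type*) [NonAssocRing A] [StarRing A] : Prop where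
  left : ∀ a b : A, a * a * b = a * (a * b)
  right : ∀ a b : A, b * a * a = b * (a * a)
  norm_comm : ∀ a b : A, (a * star a) * b = b * (a * star a)
  three_assoc : ∀ a b c : A, associator a b c + associator a b c + associator a b c = 0
  assoc_star_left : ∀ a b c : A, associator (star a) b c = associator a b c

theorem starIter_eq_ite (m : ℕ) (a : A) : starIter m a = if Even m then a else star a := by
  induction m with
  | zero => simp [starIter]
  | succ m ih => by_cases h : Even m <;> simp [starIter, ih, h, Nat.even_add_one]

/-- The coefficient of the associator of `aX^m`, `bX^n`, `cX^k` in `A[X;*]^fl`. -/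
def monomialAssociator (m n k : ℕ) (a b c : A) : A :=
  tau k (tau n a (starIter m b)) (starIter (m + n) c) -
    tau (n + k) a (starIter m (tau k b (starIter n c)))

namespace IsFlippable

theorem of_nucleus (hl : ∀ a b : A, a * a * b = a * (a * b))
    (hr : ∀ a b : A, b * a * a = b * (a * a))
    (hn : ∀ a b : A, (a * star a) * b = b * (a * star a))
    (hnuc : ∀ a b c : A, ((2 • a + star a) * b) * c = (2 • a + star a) * (b * c)) :
    IsFlippable A := by
  have key (a b c : A) :
      associator a b c + associator a b c + associator (star a) b c = 0 := by
    have h1 := hnuc a b c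
    simp only [two_smul, add_mul] at h1
    simp only [associator_apply]
    grind
  have three (a b c : A) :
      associator a b c + associator a b c + associator a b c = 0 := by
    have h1 := key a b c
    have h2 := key (star a) b c
    rw [star_star] at h2
    linear_combination (norm := abel) 2 • h1 - h2
  exact ⟨hl, hr, hn, three, fun a b c => by
    linear_combination (norm := abel) key a b c - three a b c⟩

theorem assoc_star_mid (h : IsFlippable A) (a b c : A) :
    associator a (star b) c = associator a b c := by
  rw [associator_swap_left h.left, h.assoc_star_left, ← associator_swap_left h.left]

theorem assoc_star_right (h : IsFlippable A) (a b c : A) :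
    associator a b (star c) = associator a b c := by
  rw [associator_swap_right h.right, h.assoc_star_mid, ← associator_swap_right h.right]

theorem mul_mul_add_star (h : IsFlippable A) (a b c : A) :
    c * (a * b) + c * (star a * b) = c * (b * a) + c * (b * star a) := by
  rw [← mul_add, ← mul_add, ← mul_add, ← add_mul, add_star_mul_comm h.norm_comm]

theorem add_star_mul_mul (h : IsFlippable A) (a b c : A) : a * (b * c) + star a * (b * c) =
    b * (a * c) + b * (star a * c) - associator a b c := by
  have h1 : a * (b * c) + star a * (b * c) = (b * c) * a + b * c * star a := by
    rw [← mul_add, ← add_mul, add_star_mul_comm h.norm_comm]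
  have h2 := h.mul_mul_add_star a c b
  have h3 := h.three_assoc a b c
  have h4 := associator_swap_left h.left a b c
  have h5 := associator_swap_right h.right b a c
  simp only [mul_mul_eq_add_associator, h.assoc_star_right] at h1
  linear_combination (norm := abel) h1 - h2 + h3 - 2 • h4 + 2 • h5

theorem monomialAssociator_swap_left (h : IsFlippable A) (m n k : ℕ) (a b c : A) :
    monomialAssociator m n k a b c + monomialAssociator n m k b a c = 0 := by
  have h1 := associator_swap_left h.left a b c
  have h2 := associator_swap_right h.right a b c
  have h3 := associator_swap_left h.left a c b
  have h4 := associator_swap_right h.right b a c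
  have h5 := associator_swap_right h.right c a b
  have hc := h.mul_mul_add_star
  have ha := h.add_star_mul_mul
  have ha' (a b c : A) := h.add_star_mul_mul a (star b) c
  have hn := mul_star_add_mul_star_comm h.norm_comm (star a) (star b) c
  have hn' := mul_star_add_mul_star_comm h.norm_comm (star a) (star b) (star c)
  simp only [star_star, mul_mul_eq_add_associator, h.assoc_star_left, h.assoc_star_mid,
    h.assoc_star_right] at ha' hn hn'
  by_cases pm : Even m <;> by_cases pn : Even n <;> by_cases pk : Even k <;>
    simp only [monomialAssociator, tau, starIter_eq_ite, Nat.even_add, pm, pn, pk, if_true,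
      if_false, iff_true, iff_false, not_true, star_star, star_mul,
      mul_mul_eq_add_associator, h.assoc_star_left, h.assoc_star_mid, h.assoc_star_right] <;>
    clear pm pn pk
  · grind
  · grind
  · linear_combination (norm := abel) hc a (star c) b + h.three_assoc b a c - h4
  · linear_combination (norm := abel) -(ha' a c b) - hc a b (star c)
  · linear_combination (norm := abel) hc b (star c) a + h.three_assoc a b c - h2
  · linear_combination (norm := abel) -(ha' b c a) - hc b a (star c)
  · grind
  · grind

theorem monomialAssociator_swap_right (h : IsFlippable A) (m n k : ℕ) (a b c : A) :
    monomialAssociator k m n c a b + monomialAssociator k n m c b a = 0 := by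
  have h1 := associator_swap_left h.left a b c
  have h2 := associator_swap_right h.right a b c
  have h3 := associator_swap_left h.left a c b
  have h4 := associator_swap_right h.right b a c
  have h5 := associator_swap_right h.right c a b
  have hc := h.mul_mul_add_star
  have ha := h.add_star_mul_mul
  have ha' (a b c : A) := h.add_star_mul_mul a (star b) c
  have hn := mul_star_add_mul_star_comm h.norm_comm a b c
  have hn' := mul_star_add_mul_star_comm h.norm_comm (star a) (star b) c
  simp only [star_star, mul_mul_eq_add_associator, h.assoc_star_left, h.assoc_star_mid] at ha' hn hn'
  by_cases pm : Even m <;> by_cases pn : Even n <;> by_cases pk : Even k <;>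
    simp only [monomialAssociator, tau, starIter_eq_ite, Nat.even_add, pm, pn, pk, if_true,
      if_false, iff_true, iff_false, not_true, star_star, star_mul,
      mul_mul_eq_add_associator, h.assoc_star_left, h.assoc_star_mid, h.assoc_star_right] <;>
    clear pm pn pk
  · grind
  · grind
  · linear_combination (norm := abel) -(hc a c b) - h.three_assoc b a c + h4
  · linear_combination (norm := abel) -(ha' a b c) - hc a c (star b) + h4 - h1
  · linear_combination (norm := abel) -(hc b c a) - h.three_assoc a b c + h2
  · linear_combination (norm := abel) -(ha' b a c) - hc b c (star a) + h2 - h1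
  · grind
  · grind

theorem monomialAssociator_self_left (h : IsFlippable A) (m k : ℕ) (a c : A) :
    monomialAssociator m m k a a c = 0 := by
  have h1 : associator a a c = 0 := by simp [associator_apply, h.left]
  have h2 : associator c a a = 0 := by simp [associator_apply, h.right]
  have hn := h.norm_comm a c
  have hn' := h.norm_comm (star a) c
  have hn'' := h.norm_comm (star a) (star c)
  have hc := h.mul_mul_add_star a a c
  simp only [star_star, mul_mul_eq_add_associator, h.assoc_star_left, h.assoc_star_mid,
    h.assoc_star_right] at hn hn' hn''
  by_cases hm : Even m <;> by_cases hk : Even k <;>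
    simp only [monomialAssociator, tau, starIter_eq_ite, Nat.even_add, hm, hk, if_true,
      if_false, iff_true, iff_false, not_true, star_star, star_mul,
      mul_mul_eq_add_associator, h.assoc_star_left, h.assoc_star_mid] <;>
    clear hm hk <;> grind

theorem monomialAssociator_self_right (h : IsFlippable A) (m k : ℕ) (a c : A) :
    monomialAssociator k m m c a a = 0 := by
  have h1 : associator a a c = 0 := by simp [associator_apply, h.left]
  have h2 : associator c a a = 0 := by simp [associator_apply, h.right]
  have hn := h.norm_comm a c
  have hn' := h.norm_comm (star a) c
  have hc := h.mul_mul_add_star a a c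
  simp only [star_star, mul_mul_eq_add_associator, h.assoc_star_left, h.assoc_star_mid] at hn hn'
  by_cases hm : Even m <;> by_cases hk : Even k <;>
    simp only [monomialAssociator, tau, starIter_eq_ite, Nat.even_add, hm, hk, if_true,
      if_false, iff_true, iff_false, not_true, star_star, star_mul,
      mul_mul_eq_add_associator, h.assoc_star_left, h.assoc_star_mid, h.assoc_star_right] <;>
    clear hm hk <;> grind

end IsFlippable

theorem starIter_add (m : ℕ) (a b : A) : starIter m (a + b) = starIter m a + starIter m b := by
  rw [starIter_eq_ite, starIter_eq_ite, starIter_eq_ite]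
  split_ifs <;> simp

theorem starIter_zero_right (m : ℕ) : starIter m (0 : A) = 0 := by
  simp [starIter_eq_ite]

theorem fmul_add_left (p q r : ℕ →₀ A) : fmul (p + q) r = fmul p r + fmul q r := by
  unfold fmul
  apply Finsupp.sum_add_index' <;> intros <;>
    simp [tau_zero_left, tau_add_left, Finsupp.sum_add]

theorem fmul_add_right (p q r : ℕ →₀ A) : fmul p (q + r) = fmul p q + fmul p r := by
  unfold fmul
  rw [← Finsupp.sum_add]
  refine Finsupp.sum_congr fun m _ => ?_
  apply Finsupp.sum_add_index' <;> intros <;>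
    simp [tau_zero_right, tau_add_right, starIter_zero_right, starIter_add]

theorem fmul_single_single (m n : ℕ) (a b : A) :
    fmul (Finsupp.single m a) (Finsupp.single n b) =
      Finsupp.single (m + n) (tau n a (starIter m b)) := by
  simp [fmul, Finsupp.sum_single_index, tau_zero_left, tau_zero_right, starIter_zero_right]

/-- The associator of `A[X;*]^fl`, as a triadditive map. -/
noncomputable def flippedAssociator : (ℕ →₀ A) →+ (ℕ →₀ A) →+ (ℕ →₀ A) →+ (ℕ →₀ A) :=
  AddMonoidHom.mk' (fun p => AddMonoidHom.mk' (fun q => AddMonoidHom.mk'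
    (fun r => fmul (fmul p q) r - fmul p (fmul q r))
    fun _ _ => by simp only [fmul_add_right]; abel)
    fun _ _ => AddMonoidHom.ext fun r => by
      simp only [AddMonoidHom.mk'_apply, AddMonoidHom.add_apply, fmul_add_left, fmul_add_right]
      abel)
    fun _ _ => AddMonoidHom.ext fun q => AddMonoidHom.ext fun r => by
      simp only [AddMonoidHom.mk'_apply, AddMonoidHom.add_apply, fmul_add_left]
      abel

theorem flippedAssociator_apply (p q r : ℕ →₀ A) :
    flippedAssociator p q r = fmul (fmul p q) r - fmul p (fmul q r) := rfl

theorem flippedAssociator_single (m n k : ℕ) (a b c : A) :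
    flippedAssociator (Finsupp.single m a) (Finsupp.single n b) (Finsupp.single k c) =
      Finsupp.single (m + n + k) (monomialAssociator m n k a b c) := by
  simp only [flippedAssociator_apply, fmul_single_single, monomialAssociator,
    Finsupp.single_sub, add_assoc]

end

theorem Finsupp.biadditive_self_eq_zero {ι M N : Type*} [AddCommGroup M] [AddCommGroup N]
    (f : (ι →₀ M) →+ (ι →₀ M) →+ N)
    (hself : ∀ i a, f (Finsupp.single i a) (Finsupp.single i a) = 0)
    (hswap : ∀ i j a b, f (Finsupp.single i a) (Finsupp.single j b) +
      f (Finsupp.single j b) (Finsupp.single i a) = 0) (p : ι →₀ M) : f p p = 0 := by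
  have swap (q r : ι →₀ M) : f q r + f r q = 0 := by
    induction q using Finsupp.induction_linear with
    | zero => simp
    | add q₁ q₂ h₁ h₂ =>
      simp only [map_add, AddMonoidHom.add_apply]
      linear_combination (norm := abel) h₁ + h₂
    | single i a =>
      induction r using Finsupp.induction_linear with
      | zero => simp
      | add r₁ r₂ h₁ h₂ =>
        simp only [map_add, AddMonoidHom.add_apply]
        linear_combination (norm := abel) h₁ + h₂
      | single j b => exact hswap i j a b
  induction p using Finsupp.induction_linear with
  | zero => simp
  | add q r h₁ h₂ =>
    simp only [map_add, AddMonoidHom.add_apply]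
    linear_combination (norm := abel) h₁ + h₂ + swap q r
  | single i a => exact hself i a

section

variable {A : Type*} [NonAssocRing A] [StarRing A]

theorem IsFlippable.flippedAssociator_self_left (h : IsFlippable A) (p q : ℕ →₀ A) :
    flippedAssociator p p q = 0 := by
  induction q using Finsupp.induction_linear with
  | zero => simp
  | add q r h₁ h₂ => rw [map_add, h₁, h₂, add_zero]
  | single k c =>
    refine Finsupp.biadditive_self_eq_zero
      ((AddMonoidHom.compHom (AddMonoidHom.eval (Finsupp.single k c))).comp flippedAssociator)
      (fun m a => ?_) (fun m n a b => ?_) p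
    · simp [flippedAssociator_single, h.monomialAssociator_self_left]
    · simp [flippedAssociator_single, add_comm n m, ← Finsupp.single_add,
        h.monomialAssociator_swap_left]

theorem IsFlippable.flippedAssociator_self_right (h : IsFlippable A) (p q : ℕ →₀ A) :
    flippedAssociator q p p = 0 := by
  induction q using Finsupp.induction_linear with
  | zero => simp
  | add q r h₁ h₂ => simp only [map_add, AddMonoidHom.add_apply, h₁, h₂, add_zero]
  | single k c =>
    refine Finsupp.biadditive_self_eq_zero (flippedAssociator (Finsupp.single k c))
      (fun m a => ?_) (fun m n a b => ?_) p
    · simp [flippedAssociator_single, h.monomialAssociator_self_right]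
    · simp [flippedAssociator_single, add_right_comm k n m, ← Finsupp.single_add,
        h.monomialAssociator_swap_right]

end

/-- `B = A[X;*]^fl` is alternative if and only if `A` is alternative, `aa*`
commutes with every element of `A`, and `2a + a*` lies in the nucleus `N(A)` for every
`a ∈ A`. -/
theorem flipped_skew_polynomial_ring_alternative_iff
    {A : Type*} [NonAssocRing A] [StarRing A] :
    (∀ p q : ℕ →₀ A,
        fmul (fmul p p) q = fmul p (fmul p q) ∧ fmul (fmul q p) p = fmul q (fmul p p)) ↔
      ((∀ a b : A, (a * a) * b = a * (a * b) ∧ (b * a) * a = b * (a * a)) ∧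
       (∀ a b : A, (a * star a) * b = b * (a * star a)) ∧
       (∀ a b c : A,
         ((2 • a + star a) * b) * c = (2 • a + star a) * (b * c) ∧
         (b * (2 • a + star a)) * c = b * ((2 • a + star a) * c) ∧
         (b * c) * (2 • a + star a) = b * (c * (2 • a + star a)))) := by
  constructor
  · intro h
    have left (p q : ℕ →₀ A) : flippedAssociator p p q = 0 := by
      rw [flippedAssociator_apply, (h p q).1, sub_self]
    have right (p q : ℕ →₀ A) : flippedAssociator q p p = 0 := by
      rw [flippedAssociator_apply, (h p q).2, sub_self]
    have hl (a b : A) : a * a * b = a * (a * b) := by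
      have := left (Finsupp.single 0 a) (Finsupp.single 0 b)
      rw [flippedAssociator_single, Finsupp.single_eq_zero] at this
      simpa [monomialAssociator, tau, starIter, sub_eq_zero] using this
    have hr (a b : A) : b * a * a = b * (a * a) := by
      have := right (Finsupp.single 0 a) (Finsupp.single 0 b)
      rw [flippedAssociator_single, Finsupp.single_eq_zero] at this
      simpa [monomialAssociator, tau, starIter, sub_eq_zero] using this
    have hn (a b : A) : a * (star a * b) = b * (a * star a) := by
      have := right (Finsupp.single 1 (star a)) (Finsupp.single 0 b)
      rw [flippedAssociator_single, Finsupp.single_eq_zero] at this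
      simpa [monomialAssociator, tau, starIter, sub_eq_zero] using this
    have hmix (a b c : A) :
        b * a * c - b * c * a + (b * star a * c - b * (c * star a)) = 0 := by
      have := left (Finsupp.single 0 a + Finsupp.single 1 b) (Finsupp.single 0 (star c))
      simp only [map_add, AddMonoidHom.add_apply, left, zero_add, add_zero,
        flippedAssociator_single, ← Finsupp.single_add, Finsupp.single_eq_zero] at this
      simpa [monomialAssociator, tau, starIter, add_comm] using this
    have hcomm (a c : A) : (a + star a) * c = c * (a + star a) := by
      have := hmix a 1 c
      simp only [one_mul] at this
      rw [add_mul, mul_add]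
      linear_combination (norm := abel) this
    have hmid (a b c : A) :
        associator b a c + associator b a c + associator b (star a) c = 0 := by
      have h1 := hmix a b c
      have h2 := associator_swap_right hr b a c
      have h3 : b * ((a + star a) * c) = b * (c * (a + star a)) := by rw [hcomm]
      simp only [add_mul, mul_add] at h3
      simp only [associator_apply] at h2 ⊢
      linear_combination (norm := abel) h1 - h3 + h2
    have hleft (a b c : A) :
        associator a b c + associator a b c + associator (star a) b c = 0 := by
      rw [associator_swap_left hl a, associator_swap_left hl (star a)]
      linear_combination (norm := abel) -(hmid a b c)
    have hright (a b c : A) :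
        associator b c a + associator b c a + associator b c (star a) = 0 := by
      rw [associator_swap_right hr b c a, associator_swap_right hr b c (star a)]
      linear_combination (norm := abel) -(hmid a b c)
    refine ⟨fun a b => ⟨hl a b, hr a b⟩, fun a b => ?_, fun a b c => ⟨?_, ?_, ?_⟩⟩
    · have h1 := hleft (star a) a b
      have h2 : associator a a b = 0 := by rw [associator_apply, hl, sub_self]
      have h3 := hmid a a b
      have h4 := hn a b
      simp only [h2, zero_add, associator_apply] at h3
      linear_combination (norm := abel) h3 + h4
    · have := hleft a b c
      simp only [associator_apply] at this
      simp only [two_smul, add_mul]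
      linear_combination (norm := abel) this
    · have := hmid a b c
      simp only [associator_apply] at this
      simp only [two_smul, add_mul, mul_add]
      linear_combination (norm := abel) this
    · have := hright a b c
      simp only [associator_apply] at this
      simp only [two_smul, mul_add]
      linear_combination (norm := abel) this
  · rintro ⟨halt, hn, hnuc⟩ p q
    have h := IsFlippable.of_nucleus (fun a b => (halt a b).1) (fun a b => (halt a b).2) hn
      fun a b c => (hnuc a b c).1
    exact ⟨sub_eq_zero.mp (h.flippedAssociator_self_left p q),
      sub_eq_zero.mp (h.flippedAssociator_self_right p q)⟩
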